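/- Let α, β, c, μ be real numbers such that c+α ≠ 0, c+β ≠ 0, 2c+α+β ≠ 0, the denominators of the shifted associated Jacobi recurrence are nonzero for all n ≥ 0, the Pochhammer symbols (c+1)_k, (c+β+1)_k, (c+α+β+1)_n, (2c+α+β+1)_n are nonzero, and 2c(c+β) + μ(2c+α+β)(2c+α+β+1) ≠ 0; set G = 2c(c+β)(2c+α+β) / [2c(c+β) + μ(2c+α+β)(2c+α+β+1)], assumed not a nonpositive integer. Let R_n^{α,β}(x; c, μ) be the shifted co-recursive associated Jacobi polynomials. Then for every n ≥ 0 and every x, R_n^{α,β}(x; c, μ) = (−1)^n [ (2c+α+β+1)_n (β+c+1)_n / (n! (c+α+β+1)_n) ] · ∑_{k=0}^n [ (−n)_k (n+2c+α+β+1)_k / ((c+1)_k (c+β+1)_k) ] · ( ∑_{j=0}^{n−k} [ (k−n)_j (n+k+2c+α+β+1)_j (c)_j (c+β)_j (G+1)_j ] / [ (c+k+1)_j (c+β+k+1)_j (2c+α+β+1)_j (G)_j j! ] ) · x^k. -/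

import Mathlib

/-- Pochhammer symbol `(a)_k` for real `a`. -/
noncomputable def pochR (a : ℝ) (k : ℕ) : ℝ := (ascPochhammer ℝ k).eval a

lemma pochR_zero (a : ℝ) : pochR a 0 = 1 := by simp [pochR]

lemma pochR_succ (a : ℝ) (k : ℕ) : pochR a (k + 1) = pochR a k * (a + k) := by
  simp [pochR, ascPochhammer_succ_eval]

lemma pochR_succ_left (a : ℝ) (k : ℕ) : pochR a (k + 1) = a * pochR (a + 1) k := by
  induction k with
  | zero => simp [pochR_succ, pochR_zero]
  | succ k ih => rw [pochR_succ, ih, pochR_succ]; push_cast; ring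

lemma pochR_add (a : ℝ) (k j : ℕ) : pochR a (k + j) = pochR a k * pochR (a + k) j := by
  induction j with
  | zero => simp [pochR_zero]
  | succ j ih => rw [← add_assoc, pochR_succ, ih, pochR_succ]; push_cast; ring

lemma pochR_neg_eq_zero (n m : ℕ) (h : n < m) : pochR (-(n : ℝ)) m = 0 := by
  obtain ⟨j, rfl⟩ := Nat.exists_eq_add_of_lt h
  rw [show n + j + 1 = (n + 1) + j by ring, pochR_add, pochR_succ]
  simp

/-- Ratio identity `(G+1)_j G = (G)_j (G+j)`. -/
lemma pochR_shift (G : ℝ) (j : ℕ) : pochR (G + 1) j * G = pochR G j * (G + j) := by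
  rw [← pochR_succ, pochR_succ_left]; ring

lemma pochR_ne_of (a : ℝ) (h : ∀ k : ℕ, a ≠ -(k : ℝ)) (n : ℕ) : pochR a n ≠ 0 := by
  induction n with
  | zero => simp [pochR_zero]
  | succ n ih =>
    rw [pochR_succ]
    exact mul_ne_zero ih (fun h0 => h n (by linarith))

/-- The weights of the inner sum. -/
noncomputable def wt (c β s G : ℝ) (j : ℕ) : ℝ :=
  pochR c j * pochR (c + β) j * pochR (G + 1) j / (pochR s j * pochR G j * (Nat.factorial j : ℝ))

/-- `A_m(x) = ∑_{j ≤ m} w_j x^{m-j}`. -/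
noncomputable def Apol (c β s G x : ℝ) (m : ℕ) : ℝ :=
  ∑ k ∈ Finset.range (m + 1), wt c β s G (m - k) * x ^ k

lemma Apol_succ (c β s G x : ℝ) (m : ℕ) :
    Apol c β s G x (m + 1) = x * Apol c β s G x m + wt c β s G (m + 1) := by
  unfold Apol
  rw [Finset.sum_range_succ', Finset.mul_sum]
  congr 1
  · apply Finset.sum_congr rfl
    intro k _
    rw [Nat.add_sub_add_right, pow_succ]; ring
  · simp

lemma Apol_zero (c β s G x : ℝ) : Apol c β s G x 0 = 1 := by
  simp [Apol, wt, pochR_zero]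

/-- `φ_m(n) / ((c+1)_m (c+β+1)_m)`. -/
noncomputable def bco (c β s t : ℝ) (m : ℕ) : ℝ :=
  pochR (-t) m * pochR (t + s) m / (pochR (c + 1) m * pochR (c + β + 1) m)

noncomputable def Ssum (c β s G x : ℝ) (n : ℕ) : ℝ :=
  ∑ m ∈ Finset.range (n + 1), bco c β s n m * Apol c β s G x m

lemma Ssum_ext (c β s G x : ℝ) (n N : ℕ) (h : n + 1 ≤ N) :
    Ssum c β s G x n = ∑ m ∈ Finset.range N, bco c β s n m * Apol c β s G x m := by
  unfold Ssum
  apply Finset.sum_subset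
  · intro a ha; simp at *; omega
  · intro m _ hm
    have : n < m := by simp at hm; omega
    simp [bco, pochR_neg_eq_zero n m this]

lemma doubleSum (c β s G x : ℝ) (n : ℕ)
    (hp1 : ∀ k : ℕ, pochR (c + 1) k ≠ 0)
    (hp2 : ∀ k : ℕ, pochR (c + β + 1) k ≠ 0) :
    ∑ k ∈ Finset.range (n + 1),
          pochR (-(n : ℝ)) k * pochR ((n : ℝ) + s) k /
              (pochR (c + 1) k * pochR (c + β + 1) k) *
            (∑ j ∈ Finset.range (n - k + 1),
              pochR ((k : ℝ) - (n : ℝ)) j * pochR ((n : ℝ) + (k : ℝ) + s) j *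
                  pochR c j * pochR (c + β) j * pochR (G + 1) j /
                (pochR (c + (k : ℝ) + 1) j * pochR (c + β + (k : ℝ) + 1) j *
                  pochR s j * pochR G j * (Nat.factorial j : ℝ))) * x ^ k
      = Ssum c β s G x n := by
  unfold Ssum Apol
  simp_rw [Finset.mul_sum]
  have := Finset.sum_range_diag_flip (n + 1)
    (fun k j => bco c β s n (k + j) * (wt c β s G j * x ^ k))
  have e : ∀ m ∈ Finset.range (n + 1), (∑ i ∈ Finset.range (m + 1),
      bco c β s n m * (wt c β s G (m - i) * x ^ i)) =
      ∑ i ∈ Finset.range (m + 1),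
      bco c β s n (i + (m - i)) * (wt c β s G (m - i) * x ^ i) := by
    intro m _
    apply Finset.sum_congr rfl
    intro i hi
    have : i + (m - i) = m := by simp at hi; omega
    rw [this]
  rw [Finset.sum_congr rfl e, this]
  apply Finset.sum_congr rfl
  intro k hk
  have hk' : n + 1 - k = n - k + 1 := by simp at hk; omega
  rw [hk', Finset.sum_mul]
  apply Finset.sum_congr rfl
  intro j _
  unfold bco wt
  rw [pochR_add, pochR_add, pochR_add (c + 1), pochR_add (c + β + 1)]
  rw [show (-(n : ℝ) + k) = k - n by ring, show (n : ℝ) + s + k = n + k + s by ring,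
    show c + 1 + (k : ℝ) = c + k + 1 by ring, show c + β + 1 + (k : ℝ) = c + β + k + 1 by ring]
  simp only [div_eq_mul_inv, mul_inv]
  ring

lemma sum1 (s t : ℝ) (hs : ∀ m : ℕ, pochR s m ≠ 0) (M : ℕ) :
    ∑ m ∈ Finset.range (M + 1),
      pochR (-t) m * pochR (t + s) m / (pochR s (m + 1) * (Nat.factorial m : ℝ)) =
    pochR (1 - t) M * pochR (t + s + 1) M / (pochR s (M + 1) * (Nat.factorial M : ℝ)) := by
  induction M with
  | zero => simp [pochR_zero]
  | succ M ih =>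
    rw [Finset.sum_range_succ, ih]
    have h1 := hs (M + 1)
    have h2 := hs (M + 2)
    rw [pochR_succ s (M + 1)] at h2 ⊢
    have h3 := right_ne_zero_of_mul h2
    rw [pochR_succ_left (-t), pochR_succ_left (t + s), pochR_succ (1 - t), pochR_succ (t + s + 1),
      Nat.factorial_succ, show -t + 1 = 1 - t by ring]
    have h4 : (Nat.factorial M : ℝ) ≠ 0 := by positivity
    have h5 : (M : ℝ) + 1 ≠ 0 := by positivity
    push_cast at *
    field_simp
    ring

lemma sum2 (s t : ℝ) (hs : ∀ m : ℕ, pochR s m ≠ 0) (h1 : t ≠ 0) (h2 : t + s ≠ 0)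
    (M : ℕ) :
    (t + 1) * (t + s - 1) * ∑ m ∈ Finset.range (M + 1),
      pochR (-t) m * pochR (t + s) m / (pochR s (m + 1) * (Nat.factorial (m + 1) : ℝ)) =
    1 - pochR (-t) (M + 1) * pochR (t + s) (M + 1) / (pochR s (M + 1) *
      (Nat.factorial (M + 1) : ℝ)) * (1 - (M + 1) / (t * (t + s))) := by
  induction M with
  | zero =>
    have := hs 1
    simp [pochR_zero, pochR_succ] at *
    field_simp
    ring
  | succ M ih =>
    rw [Finset.sum_range_succ, mul_add, ih]
    have h1 := hs (M + 1)
    have h2 := hs (M + 2)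
    rw [pochR_succ s (M + 1)] at h2 ⊢
    have h3 := right_ne_zero_of_mul h2
    rw [pochR_succ (-t) (M + 1), pochR_succ (t + s) (M + 1), 
      Nat.factorial_succ (M + 1)]
    have h4 : (Nat.factorial (M + 1) : ℝ) ≠ 0 := by positivity
    have h5 : (M : ℝ) + 1 + 1 ≠ 0 := by positivity
    push_cast at *
    field_simp
    ring

/-- Boundary sum. -/
lemma bsum (c β s G : ℝ) (n : ℕ) (hn : 1 ≤ n)
    (hp1 : ∀ k : ℕ, pochR (c + 1) k ≠ 0)
    (hp2 : ∀ k : ℕ, pochR (c + β + 1) k ≠ 0)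
    (hs : ∀ m : ℕ, pochR s m ≠ 0) (hG : ∀ m : ℕ, pochR G m ≠ 0) :
    ((n : ℝ) + 1) * (n + s - 1) *
      ∑ m ∈ Finset.range (n + 1), bco c β s n m * wt c β s G (m + 1) = c * (c + β) := by
  have hG0 : G ≠ 0 := by simpa [pochR_succ, pochR_zero] using hG 1
  have hns : (n : ℝ) + s ≠ 0 := by
    have := hs (n + 1)
    rw [pochR_succ] at this
    rw [add_comm]; exact right_ne_zero_of_mul this
  have hn0 : (n : ℝ) ≠ 0 := by positivity
  have e : ∀ m ∈ Finset.range (n + 1), bco c β s n m * wt c β s G (m + 1) =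
      c * (c + β) * (pochR (-n) m * pochR (n + s) m /
        (pochR s (m + 1) * (Nat.factorial (m + 1) : ℝ))) +
      c * (c + β) / G * (pochR (-n) m * pochR (n + s) m /
        (pochR s (m + 1) * (Nat.factorial m : ℝ))) := by
    intro m _
    have e1 : pochR (G + 1) (m + 1) = pochR G (m + 1) * (G + (m + 1)) / G := by
      rw [eq_div_iff hG0, pochR_shift]; push_cast; ring
    unfold bco wt
    rw [e1, pochR_succ_left c, pochR_succ_left (c + β), Nat.factorial_succ]
    have := hp1 m
    have := hp2 m
    have := hs (m + 1)
    have := hG (m + 1)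
    have h4 : (Nat.factorial m : ℝ) ≠ 0 := by positivity
    have h5 : (m : ℝ) + 1 ≠ 0 := by positivity
    push_cast
    field_simp
  rw [Finset.sum_congr rfl e, Finset.sum_add_distrib, ← Finset.mul_sum, ← Finset.mul_sum,
    sum1 s n hs]
  have z1 : pochR (1 - (n : ℝ)) n = 0 := by
    obtain ⟨k, rfl⟩ : ∃ k, n = k + 1 := ⟨n - 1, by omega⟩
    have := pochR_neg_eq_zero k (k + 1) (by omega)
    rw [← this]; congr 1; push_cast; ring
  have h2 := sum2 s n hs hn0 hns n
  rw [pochR_neg_eq_zero n (n + 1) (by omega)] at h2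
  rw [z1]
  linear_combination c * (c + β) * h2

/-- coefficientwise recurrence, m ≥ 1. -/
lemma coef_succ (α β c t : ℝ) (m : ℕ)
    (hp1 : ∀ k : ℕ, pochR (c + 1) k ≠ 0)
    (hp2 : ∀ k : ℕ, pochR (c + β + 1) k ≠ 0)
    (h1 : t + 1 ≠ 0) (h2 : t + (2 * c + α + β + 1) - 1 ≠ 0) :
    (2 * t + 2 * c + α + β + 1) *
      (-((2 * t + 2 * c + α + β + 2) * (2 * t + 2 * c + α + β)) + α ^ 2 - β ^ 2) *
        bco c β (2 * c + α + β + 1) t (m + 1) +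
    (2 * t + 2 * c + α + β + 1) * ((2 * t + 2 * c + α + β + 2) * (2 * t + 2 * c + α + β)) * 2 *
        bco c β (2 * c + α + β + 1) t m +
    2 * (t + c + 1) * (2 * t + 2 * c + α + β) * (t + (2 * c + α + β + 1)) * (t + β + c + 1)
      / (t + 1) * bco c β (2 * c + α + β + 1) (t + 1) (m + 1) +
    2 * (t + c + α) * (2 * t + 2 * c + α + β + 2) * t * (t + c + α + β)
      / (t + (2 * c + α + β + 1) - 1) * bco c β (2 * c + α + β + 1) (t - 1) (m + 1) = 0 := by
  set s := 2 * c + α + β + 1 with hs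
  have a1 : pochR (-(t + 1)) (m + 1) = -(t + 1) * pochR (-t) m := by
    rw [pochR_succ_left]; congr 2; ring
  have a2 : (t + s) * pochR (t + 1 + s) (m + 1) = pochR (t + s) m * (t + s + m) * (t + s + m + 1) := by
    have := pochR_succ_left (t + s) (m + 1)
    rw [pochR_succ, pochR_succ] at this
    rw [show t + 1 + s = t + s + 1 by ring, ← this]; push_cast; ring
  have a3 : t * pochR (-(t - 1)) (m + 1) = -(pochR (-t) m * (-t + m) * (-t + m + 1)) := by
    have := pochR_succ_left (-t) (m + 1)
    rw [pochR_succ, pochR_succ] at this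
    rw [show -(t - 1) = -t + 1 by ring]
    push_cast at this
    linear_combination this
  have a4 : pochR (t - 1 + s) (m + 1) = (t + s - 1) * pochR (t + s) m := by
    rw [pochR_succ_left, show t - 1 + s + 1 = t + s by ring]; ring
  have q1 := hp1 m
  have q2 := hp2 m
  have q1' := hp1 (m + 1)
  have q2' := hp2 (m + 1)
  rw [pochR_succ] at q1' q2'
  have r1 := right_ne_zero_of_mul q1'
  have r2 := right_ne_zero_of_mul q2'
  have b1 : (t + s) / (t + 1) * bco c β s (t + 1) (m + 1) =
      - (pochR (-t) m * pochR (t + s) m * (t + s + m) * (t + s + m + 1)) /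
      (pochR (c + 1) m * (c + 1 + m) * (pochR (c + β + 1) m * (c + β + 1 + m))) := by
    unfold bco
    rw [a1, pochR_succ (c + 1), pochR_succ (c + β + 1)]
    field_simp
    linear_combination -(pochR (-t) m) * a2
  have b2 : t / (t + s - 1) * bco c β s (t - 1) (m + 1) =
      - (pochR (-t) m * (-t + m) * (-t + m + 1) * pochR (t + s) m) /
      (pochR (c + 1) m * (c + 1 + m) * (pochR (c + β + 1) m * (c + β + 1 + m))) := by
    unfold bco
    rw [a4, pochR_succ (c + 1), pochR_succ (c + β + 1)]
    field_simp
    linear_combination pochR (t + s) m * a3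
  have b3 : bco c β s t (m + 1) = (pochR (-t) m * (-t + m) * (pochR (t + s) m * (t + s + m))) /
      (pochR (c + 1) m * (c + 1 + m) * (pochR (c + β + 1) m * (c + β + 1 + m))) := by
    unfold bco
    rw [pochR_succ, pochR_succ, pochR_succ, pochR_succ]
  have b4 : bco c β s t m = (pochR (-t) m * pochR (t + s) m * ((c + 1 + m) * (c + β + 1 + m))) /
      (pochR (c + 1) m * (c + 1 + m) * (pochR (c + β + 1) m * (c + β + 1 + m))) := by
    unfold bco
    field_simp
  have c1 : 2 * (t + c + 1) * (2 * t + 2 * c + α + β) * (t + s) * (t + β + c + 1)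
      / (t + 1) * bco c β s (t + 1) (m + 1) = 2 * (t + c + 1) * (2 * t + 2 * c + α + β) *
      (t + β + c + 1) * ((t + s) / (t + 1) * bco c β s (t + 1) (m + 1)) := by ring
  have c2 : 2 * (t + c + α) * (2 * t + 2 * c + α + β + 2) * t * (t + c + α + β)
      / (t + s - 1) * bco c β s (t - 1) (m + 1) = 2 * (t + c + α) * (2 * t + 2 * c + α + β + 2) *
      (t + c + α + β) * (t / (t + s - 1) * bco c β s (t - 1) (m + 1)) := by ring
  rw [c1, c2, b1, b2, b3, b4, hs]
  ring

lemma lin4 (N : ℕ) (p q r u : ℝ) (f g h k A : ℕ → ℝ)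
    (H : ∀ m, p * f m + q * g m + r * h m + u * k m = 0) :
    p * ∑ m ∈ Finset.range N, f m * A m + q * ∑ m ∈ Finset.range N, g m * A m +
      r * ∑ m ∈ Finset.range N, h m * A m + u * ∑ m ∈ Finset.range N, k m * A m = 0 := by
  simp only [Finset.mul_sum, ← Finset.sum_add_distrib]
  apply Finset.sum_eq_zero
  intro m _
  linear_combination A m * H m

lemma S_rec (α β c G x : ℝ) (n : ℕ) (hn : 1 ≤ n)
    (hp1 : ∀ k : ℕ, pochR (c + 1) k ≠ 0)
    (hp2 : ∀ k : ℕ, pochR (c + β + 1) k ≠ 0)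
    (hs : ∀ m : ℕ, pochR (2 * c + α + β + 1) m ≠ 0) (hG : ∀ m : ℕ, pochR G m ≠ 0)
    (h2 : (n : ℝ) + (2 * c + α + β + 1) - 1 ≠ 0) :
    (2 * (n : ℝ) + 2 * c + α + β + 1) *
      ((2 * n + 2 * c + α + β + 2) * (2 * n + 2 * c + α + β) * (2 * x - 1) + α ^ 2 - β ^ 2) *
        Ssum c β (2 * c + α + β + 1) G x n +
    2 * (n + c + 1) * (2 * n + 2 * c + α + β) * (n + (2 * c + α + β + 1)) * (n + β + c + 1)
      / (n + 1) * Ssum c β (2 * c + α + β + 1) G x (n + 1) +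
    2 * (n + c + α) * (2 * n + 2 * c + α + β + 2) * n * (n + c + α + β)
      / (n + (2 * c + α + β + 1) - 1) * Ssum c β (2 * c + α + β + 1) G x (n - 1) = 0 := by
  have h1 : (n : ℝ) + 1 ≠ 0 := by positivity
  have hb := bsum c β (2 * c + α + β + 1) G n hn hp1 hp2 hs hG
  have key := fun m => coef_succ α β c n m hp1 hp2 h1 h2
  have hx : x * Ssum c β (2 * c + α + β + 1) G x n =
      ∑ m ∈ Finset.range (n + 1), bco c β (2 * c + α + β + 1) n m *
        Apol c β (2 * c + α + β + 1) G x (m + 1)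
      - ∑ m ∈ Finset.range (n + 1), bco c β (2 * c + α + β + 1) n m *
        wt c β (2 * c + α + β + 1) G (m + 1) := by
    unfold Ssum
    rw [Finset.mul_sum, ← Finset.sum_sub_distrib]
    apply Finset.sum_congr rfl
    intro m _
    rw [Apol_succ]; ring
  have e0 := Ssum_ext c β (2 * c + α + β + 1) G x n (n + 1 + 1) (by omega)
  have e1 := Ssum_ext c β (2 * c + α + β + 1) G x (n + 1) (n + 1 + 1) (by omega)
  have e2 := Ssum_ext c β (2 * c + α + β + 1) G x (n - 1) (n + 1 + 1) (by omega)
  rw [Finset.sum_range_succ'] at e0 e1 e2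
  have z : ∀ t : ℝ, bco c β (2 * c + α + β + 1) t 0 = 1 := by intro t; simp [bco, pochR_zero]
  rw [z, Apol_zero] at e0 e1 e2
  rw [Nat.cast_sub hn] at e2
  push_cast at e1 e2
  have hsum := lin4 (n + 1) _ _ _ _
    (fun m => bco c β (2 * c + α + β + 1) n (m + 1)) (fun m => bco c β (2 * c + α + β + 1) n m)
    (fun m => bco c β (2 * c + α + β + 1) (n + 1) (m + 1))
    (fun m => bco c β (2 * c + α + β + 1) (n - 1) (m + 1))
    (fun m => Apol c β (2 * c + α + β + 1) G x (m + 1)) key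
  set T := ∑ m ∈ Finset.range (n + 1), bco c β (2 * c + α + β + 1) n m *
        wt c β (2 * c + α + β + 1) G (m + 1)
  set S := Ssum c β (2 * c + α + β + 1) G x n
  have hT : T = c * (c + β) / ((n + 1) * (n + (2 * c + α + β + 1) - 1)) := by
    rw [eq_div_iff (mul_ne_zero h1 h2)]
    linear_combination hb
  have hmain : (2 * (n : ℝ) + 2 * c + α + β + 1) *
      (-((2 * n + 2 * c + α + β + 2) * (2 * n + 2 * c + α + β)) + α ^ 2 - β ^ 2)
     - 2 * (2 * (n : ℝ) + 2 * c + α + β + 1) * (2 * n + 2 * c + α + β + 2) * (2 * n + 2 * c + α + β) * T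
     + 2 * (n + c + 1) * (2 * n + 2 * c + α + β) * (n + (2 * c + α + β + 1)) * (n + β + c + 1)
      / (n + 1) +
    2 * (n + c + α) * (2 * n + 2 * c + α + β + 2) * n * (n + c + α + β)
      / (n + (2 * c + α + β + 1) - 1) = 0 := by
    rw [hT]
    field_simp
    ring
  rw [e1, e2]
  linear_combination hmain + hsum + 2 * (2 * (n : ℝ) + 2 * c + α + β + 1) * (2 * n + 2 * c + α + β + 2) * (2 * n + 2 * c + α + β) * hx + (2 * (n : ℝ) + 2 * c + α + β + 1) *
      (-((2 * n + 2 * c + α + β + 2) * (2 * n + 2 * c + α + β)) + α ^ 2 - β ^ 2) * e0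

theorem stmt17 (α β c μ : ℝ)
    (hcα : c + α ≠ 0) (hcβ : c + β ≠ 0) (hC : 2 * c + α + β ≠ 0)
    (hden : ∀ n : ℕ, ((n : ℝ) + c + 1 ≠ 0 ∧ (n : ℝ) + c + α + β + 1 ≠ 0 ∧
      2 * (n : ℝ) + 2 * c + α + β ≠ 0))
    (hp1 : ∀ k : ℕ, pochR (c + 1) k ≠ 0)
    (hp2 : ∀ k : ℕ, pochR (c + β + 1) k ≠ 0)
    (hp3 : ∀ n : ℕ, pochR (c + α + β + 1) n ≠ 0)
    (hp4 : ∀ n : ℕ, pochR (2 * c + α + β + 1) n ≠ 0)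
    (hμden : 2 * c * (c + β) + μ * (2 * c + α + β) * (2 * c + α + β + 1) ≠ 0)
    (hG : ∀ k : ℕ,
      2 * c * (c + β) * (2 * c + α + β) /
        (2 * c * (c + β) + μ * (2 * c + α + β) * (2 * c + α + β + 1)) ≠ -(k : ℝ))
    (R : ℤ → ℝ → ℝ)
    (hinitm : ∀ x : ℝ,
      R (-1) x = -μ * (2 * c + α + β) * (2 * c + α + β + 1) / (2 * (c + α) * (c + β)))
    (hinit0 : ∀ x : ℝ, R 0 x = 1)
    (hrec : ∀ n : ℕ, ∀ x : ℝ,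
      (2 * (n : ℝ) + 2 * c + α + β + 1) *
          ((2 * (n : ℝ) + 2 * c + α + β + 2) * (2 * (n : ℝ) + 2 * c + α + β) * (2 * x - 1)
            + α ^ 2 - β ^ 2) * R (n : ℤ) x
        = 2 * ((n : ℝ) + c + 1) * ((n : ℝ) + c + α + β + 1) *
            (2 * (n : ℝ) + 2 * c + α + β) * R ((n : ℤ) + 1) x
          + 2 * ((n : ℝ) + c + α) * ((n : ℝ) + c + β) *
            (2 * (n : ℝ) + 2 * c + α + β + 2) * R ((n : ℤ) - 1) x) :
    ∀ n : ℕ, ∀ x : ℝ,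
      R (n : ℤ) x = (-1 : ℝ) ^ n *
        (pochR (2 * c + α + β + 1) n * pochR (β + c + 1) n /
          ((Nat.factorial n : ℝ) * pochR (c + α + β + 1) n)) *
        ∑ k ∈ Finset.range (n + 1),
          pochR (-(n : ℝ)) k * pochR ((n : ℝ) + 2 * c + α + β + 1) k /
              (pochR (c + 1) k * pochR (c + β + 1) k) *
            (∑ j ∈ Finset.range (n - k + 1),
              pochR ((k : ℝ) - (n : ℝ)) j * pochR ((n : ℝ) + (k : ℝ) + 2 * c + α + β + 1) j *
                  pochR c j * pochR (c + β) j *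
                  pochR (2 * c * (c + β) * (2 * c + α + β) /
                    (2 * c * (c + β) + μ * (2 * c + α + β) * (2 * c + α + β + 1)) + 1) j /
                (pochR (c + (k : ℝ) + 1) j * pochR (c + β + (k : ℝ) + 1) j *
                  pochR (2 * c + α + β + 1) j *
                  pochR (2 * c * (c + β) * (2 * c + α + β) /
                    (2 * c * (c + β) + μ * (2 * c + α + β) * (2 * c + α + β + 1))) j *
                  (Nat.factorial j : ℝ))) *
            x ^ k := by
  set s := 2 * c + α + β + 1 with hsdef
  set K := 2 * c * (c + β) + μ * (2 * c + α + β) * s with hK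
  set G := 2 * c * (c + β) * (2 * c + α + β) / K with hGdef
  have hGp : ∀ m : ℕ, pochR G m ≠ 0 := pochR_ne_of G hG
  have hG0 : G ≠ 0 := by simpa using hG 0
  have hc0 : c ≠ 0 := by
    intro h; apply hG0; rw [hGdef, h]; simp
  have hsn : ∀ n : ℕ, s + n ≠ 0 := by
    intro n
    have := hp4 (n + 1)
    rw [pochR_succ] at this
    exact right_ne_zero_of_mul this
  suffices H : ∀ n : ℕ, ∀ x : ℝ, R (n : ℤ) x = (-1 : ℝ) ^ n *
        (pochR s n * pochR (c + β + 1) n /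
          ((Nat.factorial n : ℝ) * pochR (c + α + β + 1) n)) * Ssum c β s G x n by
    intro n x
    rw [H n x, ← doubleSum c β s G x n hp1 hp2, hsdef]
    simp only [add_assoc, add_comm, add_left_comm]
  intro n x
  have P0 : R ((0 : ℕ) : ℤ) x = (-1 : ℝ) ^ 0 *
        (pochR s 0 * pochR (c + β + 1) 0 /
          ((Nat.factorial 0 : ℝ) * pochR (c + α + β + 1) 0)) * Ssum c β s G x 0 := by
    have := hinit0 x
    simp [pochR_zero, Ssum, bco, Apol_zero, this]
  have P1 : R ((1 : ℕ) : ℤ) x = (-1 : ℝ) ^ 1 *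
        (pochR s 1 * pochR (c + β + 1) 1 /
          ((Nat.factorial 1 : ℝ) * pochR (c + α + β + 1) 1)) * Ssum c β s G x 1 := by
    have h := hrec 0 x
    obtain ⟨d1, d2, d3⟩ := hden 0
    have d4 := hp2 1
    have d5 := hsn 0
    have hw : wt c β s G 1 = c * (c + β) * (1 + 1 / G) / s := by
      simp [wt, pochR_succ, pochR_zero]
      simp at d5
      field_simp
    have hcG : c * (c + β) * (1 + 1 / G) = c * (c + β) + K / (2 * (2 * c + α + β)) := by
      rw [hGdef]
      field_simp
    rw [hcG] at hw
    have hS : Ssum c β s G x 1 = 1 - (1 + s) / ((c + 1) * (c + β + 1)) * (x + wt c β s G 1) := by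
      simp [Ssum, Finset.sum_range_succ, bco, pochR_succ, pochR_zero, Apol_succ, Apol_zero]
      ring
    have hi0 := hinit0 x
    have him := hinitm x
    simp [pochR_succ, pochR_zero] at *
    rw [hS, hw]
    rw [hi0, him] at h
    have : R 1 x = ((2 * c + α + β + 1) * ((2 * c + α + β + 2) * (2 * c + α + β) * (2 * x - 1) + α ^ 2 - β ^ 2) + μ * (2 * c + α + β) * s * (2 * c + α + β + 2)) / (2 * (c + 1) * (c + α + β + 1) * (2 * c + α + β)) := by
      rw [eq_div_iff (by positivity)]
      field_simp at h
      linear_combination -h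
    rw [this, hK]
    field_simp
    rw [hsdef]
    ring
  have step : ∀ k : ℕ, R ((k + 1 : ℕ) : ℤ) x = (-1 : ℝ) ^ (k + 1) *
        (pochR s (k + 1) * pochR (c + β + 1) (k + 1) /
          ((Nat.factorial (k + 1) : ℝ) * pochR (c + α + β + 1) (k + 1))) * Ssum c β s G x (k + 1) →
      R (k : ℤ) x = (-1 : ℝ) ^ k *
        (pochR s k * pochR (c + β + 1) k /
          ((Nat.factorial k : ℝ) * pochR (c + α + β + 1) k)) * Ssum c β s G x k →
      R ((k + 1 + 1 : ℕ) : ℤ) x = (-1 : ℝ) ^ (k + 1 + 1) *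
        (pochR s (k + 1 + 1) * pochR (c + β + 1) (k + 1 + 1) /
          ((Nat.factorial (k + 1 + 1) : ℝ) * pochR (c + α + β + 1) (k + 1 + 1))) *
          Ssum c β s G x (k + 1 + 1) := by
    intro k ih1 ih0
    have h := hrec (k + 1) x
    obtain ⟨d1, d2, d3⟩ := hden (k + 1)
    have d5 := hsn k
    have d5' := hsn (k + 1)
    have e5 : ((k + 1 : ℕ) : ℝ) + s - 1 ≠ 0 := by
      intro h0; apply d5; push_cast at h0; linarith
    have hS := S_rec α β c G x (k + 1) (by omega) hp1 hp2 hp4 hGp e5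
    rw [← hsdef] at hS
    have f3 := hp3 k
    have f3' := hp3 (k + 1)
    have f2 := hp2 (k + 1)
    have i1 : ((k + 1 : ℕ) : ℤ) + 1 = ((k + 1 + 1 : ℕ) : ℤ) := by push_cast; ring
    have i2 : ((k + 1 : ℕ) : ℤ) - 1 = (k : ℤ) := by push_cast; ring
    rw [i1, i2, ih1, ih0] at h
    rw [pochR_succ] at f3' f2
    have g3 := right_ne_zero_of_mul f3'
    have g2 := right_ne_zero_of_mul f2
    have f2 := hp2 k
    have f4 : (Nat.factorial k : ℝ) ≠ 0 := by positivity
    have f5 : (k : ℝ) + 1 ≠ 0 := by positivity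
    have f6 : (k : ℝ) + 1 + 1 ≠ 0 := by positivity
    simp only [Nat.add_sub_cancel] at hS
    have dd : 2 * (((k + 1 : ℕ) : ℝ) + c + 1) * (((k + 1 : ℕ) : ℝ) + c + α + β + 1) *
        (2 * ((k + 1 : ℕ) : ℝ) + 2 * c + α + β) ≠ 0 :=
      mul_ne_zero (mul_ne_zero (mul_ne_zero two_ne_zero d1) d2) d3
    apply mul_left_cancel₀ dd
    set Q := (-1 : ℝ) ^ k * (pochR s k * pochR (c + β + 1) k /
          ((Nat.factorial k : ℝ) * pochR (c + α + β + 1) k)) with hQ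
    have q1 : (-1 : ℝ) ^ (k + 1) *
        (pochR s (k + 1) * pochR (c + β + 1) (k + 1) /
          ((Nat.factorial (k + 1) : ℝ) * pochR (c + α + β + 1) (k + 1))) =
        - Q * ((s + k) * (c + β + 1 + k) / ((k + 1) * (c + α + β + 1 + k))) := by
      rw [hQ, pochR_succ, pochR_succ, pochR_succ, Nat.factorial_succ, pow_succ]
      push_cast
      field_simp
    have q2 : (-1 : ℝ) ^ (k + 1 + 1) *
        (pochR s (k + 1 + 1) * pochR (c + β + 1) (k + 1 + 1) /
          ((Nat.factorial (k + 1 + 1) : ℝ) * pochR (c + α + β + 1) (k + 1 + 1))) =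
        ((-1 : ℝ) ^ (k + 1) *
        (pochR s (k + 1) * pochR (c + β + 1) (k + 1) /
          ((Nat.factorial (k + 1) : ℝ) * pochR (c + α + β + 1) (k + 1)))) *
        (-((s + (k + 1)) * (c + β + 1 + (k + 1)) / ((k + 1 + 1) * (c + α + β + 1 + (k + 1))))) := by
      rw [pochR_succ s (k + 1), pochR_succ (c + β + 1) (k + 1), pochR_succ _ (k + 1),
        Nat.factorial_succ (k + 1), pow_succ _ (k + 1)]
      simp only [div_eq_mul_inv, mul_inv]
      push_cast
      simp only [mul_inv]
      ring
    rw [q2, q1]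
    rw [q1] at h
    clear_value Q
    have g4 : c + α + β + 1 + ((k : ℝ) + 1) ≠ 0 := by
      intro h0; apply d2; push_cast; linarith
    push_cast at *
    have u1 : 2 * ((k : ℝ) + 1 + c + 1) * (k + 1 + c + α + β + 1) * (2 * (k + 1) + 2 * c + α + β) *
      (-Q * ((s + k) * (c + β + 1 + k) / ((k + 1) * (c + α + β + 1 + k))) *
        (-((s + (k + 1)) * (c + β + 1 + (k + 1)) / ((k + 1 + 1) * (c + α + β + 1 + (k + 1))))) *
        Ssum c β s G x (k + 1 + 1)) =
      Q * ((s + k) * (c + β + 1 + k) / ((k + 1) * (c + α + β + 1 + k))) *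
       (2 * (k + 1 + c + 1) * (2 * (k + 1) + 2 * c + α + β) * (k + 1 + s) * (k + 1 + β + c + 1) / (k + 1 + 1) *
        Ssum c β s G x (k + 1 + 1)) := by
      field_simp
      ring
    have u2 : 2 * ((k : ℝ) + 1 + c + α) * (k + 1 + c + β) * (2 * (k + 1) + 2 * c + α + β + 2) *
        (Q * Ssum c β s G x k) =
      Q * ((s + k) * (c + β + 1 + k) / ((k + 1) * (c + α + β + 1 + k))) *
       (2 * (k + 1 + c + α) * (2 * (k + 1) + 2 * c + α + β + 2) * (k + 1) * (k + 1 + c + α + β) /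
          (k + 1 + s - 1) * Ssum c β s G x k) := by
      rw [show (k : ℝ) + 1 + s - 1 = s + k by ring]
      field_simp
      ring
    rw [u1]
    rw [u2] at h
    linear_combination -h - Q * ((s + k) * (c + β + 1 + k) / ((k + 1) * (c + α + β + 1 + k))) * hS
  have both : ∀ k : ℕ, (R (k : ℤ) x = (-1 : ℝ) ^ k *
        (pochR s k * pochR (c + β + 1) k /
          ((Nat.factorial k : ℝ) * pochR (c + α + β + 1) k)) * Ssum c β s G x k) ∧
      (R ((k + 1 : ℕ) : ℤ) x = (-1 : ℝ) ^ (k + 1) *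
        (pochR s (k + 1) * pochR (c + β + 1) (k + 1) /
          ((Nat.factorial (k + 1) : ℝ) * pochR (c + α + β + 1) (k + 1))) *
          Ssum c β s G x (k + 1)) := by
    intro k
    induction k with
    | zero => exact ⟨P0, P1⟩
    | succ k ih => exact ⟨ih.2, step k ih.2 ih.1⟩
  exact (both n).1
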